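/- Let a ∈ ℤ and let V be an e(2)-module generated by a single weight vector of weight a. Then there exists a partition λ₁ ≥ λ₂ ≥ ⋯ ≥ λ_l > 0 (of the integer dim_ℂ V) such that for every i ∈ ℤ, dim_ℂ V_{a+i} equals the number of pairs (r, c) with 1 ≤ r ≤ l, 1 ≤ c ≤ λ_r and c − r = i (i.e. the number of boxes of residue i in the Young diagram of λ). In particular, if a finitely supported function v : ℤ → ℕ is not of this form for any partition λ, then there is no e(2)-module with a single generator of weight a and dim_ℂ V_k = v_k for all k. -/

import Mathlib

/-- An `e(2)`-module: a finite-dimensional complex vector space `V` with endomorphisms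
`Pp = P₊`, `Pm = P₋`, `L` satisfying `P₊∘P₋ = P₋∘P₊`, `L∘P₊ − P₊∘L = P₊`,
`L∘P₋ − P₋∘L = −P₋`, such that `V` is the internal direct sum of the eigenspaces
`V_k = ker (L − k·id)`, `k ∈ ℤ`. -/
structure E2Mod : Type 1 where
  V : Type
  [acg : AddCommGroup V]
  [mod : Module ℂ V]
  [fd : FiniteDimensional ℂ V]
  Pp : V →ₗ[ℂ] V
  Pm : V →ₗ[ℂ] V
  L : V →ₗ[ℂ] V
  comm : Pp.comp Pm = Pm.comp Pp
  relp : L.comp Pp - Pp.comp L = Pp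
  relm : L.comp Pm - Pm.comp L = -Pm
  internal : DirectSum.IsInternal fun k : ℤ =>
    LinearMap.ker (L - (k : ℂ) • (LinearMap.id : V →ₗ[ℂ] V))

attribute [instance] E2Mod.acg E2Mod.mod E2Mod.fd

namespace E2Mod

/-- The `k`-weight space `V_k = ker (L - k·id)`. -/
def wt (M : E2Mod) (k : ℤ) : Submodule ℂ M.V :=
  LinearMap.ker (M.L - (k : ℂ) • (LinearMap.id : M.V →ₗ[ℂ] M.V))

/-- A subspace is a submodule if it is invariant under `P₊`, `P₋` and `L`. -/
def IsSubmod (M : E2Mod) (S : Submodule ℂ M.V) : Prop :=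
  (∀ v ∈ S, M.Pp v ∈ S) ∧ (∀ v ∈ S, M.Pm v ∈ S) ∧ (∀ v ∈ S, M.L v ∈ S)

/-- An `e(2)`-module is indecomposable if it is nonzero and admits no nontrivial
decomposition as an internal direct sum of two submodules. -/
def Indecomposable (M : E2Mod) : Prop :=
  (∃ v : M.V, v ≠ 0) ∧
    ∀ W₁ W₂ : Submodule ℂ M.V, M.IsSubmod W₁ → M.IsSubmod W₂ →
      W₁ ⊓ W₂ = ⊥ → W₁ ⊔ W₂ = ⊤ → W₁ = ⊥ ∨ W₂ = ⊥

/-- Isomorphism of `e(2)`-modules: a bijective linear map commuting with `P₊, P₋, L`. -/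
def Iso (M N : E2Mod) : Prop :=
  ∃ e : M.V ≃ₗ[ℂ] N.V,
    (∀ v, e (M.Pp v) = N.Pp (e v)) ∧ (∀ v, e (M.Pm v) = N.Pm (e v)) ∧
      (∀ v, e (M.L v) = N.L (e v))

end E2Mod

/-- `V` is generated by the set `S` if the only submodule of `V` containing `S` is `V`. -/
def E2Mod.GenBy (M : E2Mod) (S : Set M.V) : Prop :=
  ∀ W : Submodule ℂ M.V, M.IsSubmod W → S ⊆ (W : Set M.V) → W = ⊤

/-- The number of boxes of residue `i` in the Young diagram of the partition
`lam 0 ≥ lam 1 ≥ ⋯`: pairs `(r, c)` with `1 ≤ c ≤ lam r` (row `r+1`, column `c`) and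
residue `c − (r+1) = i`. -/
def boxCount (l : ℕ) (lam : Fin l → ℕ) (i : ℤ) : ℕ :=
  ((Finset.univ.sigma fun r : Fin l => Finset.Icc 1 (lam r)).filter
    (fun p => (p.2 : ℤ) - ((p.1 : ℕ) + 1 : ℤ) = i)).card

/-- The span of the vectors `x ^ m (y ^ n u)` with `m - n = i`. -/
def monomialSpan {K V : Type*} [Field K] [AddCommGroup V] [Module K V]
    (x y : Module.End K V) (u : V) (i : ℤ) : Submodule K V :=
  Submodule.span K {v | ∃ m n : ℕ, (m : ℤ) - n = i ∧ v = (x ^ m) ((y ^ n) u)}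

section MonomialSpan

variable {K V : Type*} [Field K] [AddCommGroup V] [Module K V]
  {x y : Module.End K V}

lemma monomialSpan_swap (h : Commute x y) (u : V) (i : ℤ) :
    monomialSpan x y u i = monomialSpan y x u (-i) := by
  unfold monomialSpan
  congr 1
  ext v
  have key (m n : ℕ) : (x ^ m) ((y ^ n) u) = (y ^ n) ((x ^ m) u) :=
    LinearMap.congr_fun (h.pow_pow m n).eq u
  constructor
  · rintro ⟨m, n, hi, rfl⟩
    exact ⟨n, m, by omega, key m n⟩
  · rintro ⟨m, n, hi, rfl⟩
    exact ⟨n, m, by omega, (key n m).symm⟩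

lemma map_left_monomialSpan_le (x y : Module.End K V) (u : V) (i : ℤ) :
    (monomialSpan x y u i).map x ≤ monomialSpan x y u (i + 1) := by
  unfold monomialSpan
  rw [Submodule.map_span, Submodule.span_le]
  rintro _ ⟨_, ⟨m, n, hi, rfl⟩, rfl⟩
  refine Submodule.subset_span ⟨m + 1, n, by push_cast; omega, ?_⟩
  rw [pow_succ']
  rfl

lemma map_right_monomialSpan_le (h : Commute x y) (u : V) (i : ℤ) :
    (monomialSpan x y u i).map y ≤ monomialSpan x y u (i - 1) := by
  rw [monomialSpan_swap h, monomialSpan_swap h, neg_sub, sub_eq_neg_add]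
  exact map_left_monomialSpan_le y x u (-i)

lemma monomialSpan_add_one_le_map (x y : Module.End K V) (u : V) {i : ℤ} (hi : 0 ≤ i) :
    monomialSpan x y u (i + 1) ≤ (monomialSpan x y u i).map x := by
  rw [monomialSpan, Submodule.span_le]
  rintro _ ⟨m, n, hmn, rfl⟩
  obtain ⟨m, rfl⟩ : ∃ k, m = k + 1 := ⟨m - 1, by omega⟩
  refine ⟨(x ^ m) ((y ^ n) u), Submodule.subset_span ⟨m, n, by omega, rfl⟩, ?_⟩
  rw [pow_succ']
  rfl

lemma monomialSpan_le_sup_map (h : Commute x y) (u : V) (i : ℤ) :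
    monomialSpan x y u i ≤
      Submodule.span K {(x ^ i.toNat) u} ⊔ (monomialSpan x y u (i + 1)).map y := by
  rw [monomialSpan, Submodule.span_le]
  rintro _ ⟨m, n, hmn, rfl⟩
  rcases n with _ | n
  · obtain rfl : m = i.toNat := by omega
    exact Submodule.mem_sup_left (Submodule.mem_span_singleton_self _)
  · refine Submodule.mem_sup_right ⟨(x ^ m) ((y ^ n) u),
      Submodule.subset_span ⟨m, n, by omega, rfl⟩, ?_⟩
    rw [pow_succ']
    exact (LinearMap.congr_fun (h.pow_left m).eq ((y ^ n) u)).symm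

variable [FiniteDimensional K V]

lemma finrank_monomialSpan_add_one_le (x y : Module.End K V) (u : V) {i : ℤ} (hi : 0 ≤ i) :
    Module.finrank K (monomialSpan x y u (i + 1)) ≤ Module.finrank K (monomialSpan x y u i) :=
  (Submodule.finrank_mono (monomialSpan_add_one_le_map x y u hi)).trans
    (Submodule.finrank_map_le _ _)

lemma finrank_monomialSpan_le_add_one (h : Commute x y) (u : V) (i : ℤ) :
    Module.finrank K (monomialSpan x y u i) ≤
      Module.finrank K (monomialSpan x y u (i + 1)) + 1 := by
  have h₁ := Submodule.finrank_mono (monomialSpan_le_sup_map h u i)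
  have h₂ := Submodule.finrank_add_le_finrank_add_finrank
    (Submodule.span K {(x ^ i.toNat) u}) ((monomialSpan x y u (i + 1)).map y)
  have h₃ := Submodule.finrank_map_le y (monomialSpan x y u (i + 1))
  have h₄ := finrank_span_le_card (R := K) ({(x ^ i.toNat) u} : Set V)
  simp only [Set.toFinset_singleton, Finset.card_singleton] at h₄
  omega

end MonomialSpan

/-- An independent family admits no proper subfamily with the supremum `⊤`. -/
lemma iSupIndep.eq_of_le_of_iSup_eq_top {α ι : Type*} [CompleteLattice α] [IsModularLattice α]
    {s t : ι → α} (ht : iSupIndep t) (hst : s ≤ t) (hs : ⨆ i, s i = ⊤) : s = t := by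
  funext i
  refine le_antisymm (hst i) ?_
  have h₁ : s i ⊔ ⨆ (j) (_ : j ≠ i), s j = ⊤ := by
    rw [eq_top_iff, ← hs]
    refine iSup_le fun j => ?_
    by_cases hj : j = i
    · exact hj ▸ le_sup_left
    · exact le_sup_of_le_right (le_iSup₂_of_le j hj le_rfl)
  have h₂ : (⨆ (j) (_ : j ≠ i), s j) ⊓ t i = ⊥ :=
    ((ht i).mono_right (iSup₂_mono fun j _ => hst j)).symm.eq_bot
  calc t i = (s i ⊔ ⨆ (j) (_ : j ≠ i), s j) ⊓ t i := by rw [h₁, top_inf_eq]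
    _ = s i ⊔ (⨆ (j) (_ : j ≠ i), s j) ⊓ t i := sup_inf_assoc_of_le _ (hst i)
    _ ≤ s i := by rw [h₂, sup_bot_eq]

/-- A finitely supported function on `ℤ` that weakly decreases in steps of at most one away
from `0` counts the boxes of given residue in a Young diagram. -/
lemma exists_youngDiagram_of_steps (f : ℤ → ℕ) (hf : f.support.Finite)
    (hpos : ∀ i, 0 ≤ i → f (i + 1) ≤ f i ∧ f i ≤ f (i + 1) + 1)
    (hneg : ∀ i, i ≤ 0 → f (i - 1) ≤ f i ∧ f i ≤ f (i - 1) + 1) :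
    ∃ μ : YoungDiagram, ∀ r c : ℕ, (r, c) ∈ μ ↔ min r c < f (c - r) := by
  classical
  let cells : Finset (ℕ × ℕ) := (hf.toFinset.sigma fun i => Finset.range (f i)).image
    fun p => (p.2 + (-p.1).toNat, p.2 + p.1.toNat)
  have hcells (r c : ℕ) : (r, c) ∈ cells ↔ min r c < f (c - r) := by
    simp only [cells, Finset.mem_image, Finset.mem_sigma, Set.Finite.mem_toFinset,
      Function.mem_support, Finset.mem_range, Sigma.exists, Prod.mk.injEq]
    constructor
    · rintro ⟨i, k, ⟨-, hk⟩, rfl, rfl⟩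
      have h₁ : min (k + (-i).toNat) (k + i.toNat) = k := by omega
      have h₂ : ((k + i.toNat : ℕ) : ℤ) - (k + (-i).toNat : ℕ) = i := by omega
      rwa [h₁, h₂]
    · intro h
      exact ⟨c - r, min r c, ⟨by omega, h⟩, by omega, by omega⟩
  have hrow (r c : ℕ) (h : (r, c + 1) ∈ cells) : (r, c) ∈ cells := by
    rw [hcells] at h ⊢
    rcases le_or_gt r c with hrc | hrc
    · have := (hpos ((c : ℤ) - r) (by omega)).1
      rw [show (c : ℤ) - r + 1 = (c + 1 : ℕ) - r by push_cast; ring] at this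
      omega
    · have := (hneg ((c + 1 : ℕ) - (r : ℤ)) (by omega)).2
      rw [show ((c + 1 : ℕ) : ℤ) - r - 1 = c - r by push_cast; ring] at this
      omega
  have hcol (r c : ℕ) (h : (r + 1, c) ∈ cells) : (r, c) ∈ cells := by
    rw [hcells] at h ⊢
    rcases le_or_gt c r with hrc | hrc
    · have := (hneg ((c : ℤ) - r) (by omega)).1
      rw [show (c : ℤ) - r - 1 = c - (r + 1 : ℕ) by push_cast; ring] at this
      omega
    · have := (hpos ((c : ℤ) - (r + 1 : ℕ)) (by omega)).2
      rw [show (c : ℤ) - (r + 1 : ℕ) + 1 = c - r by push_cast; ring] at this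
      omega
  refine ⟨⟨cells, ?_⟩, hcells⟩
  rintro ⟨r, c⟩ ⟨r', c'⟩ ⟨hr, hc⟩ h
  obtain ⟨d, rfl⟩ := Nat.exists_eq_add_of_le hr
  obtain ⟨e, rfl⟩ := Nat.exists_eq_add_of_le hc
  have h' : (r' + d, c') ∈ cells := by
    clear hr hc
    induction e with
    | zero => exact h
    | succ e ih => exact ih (hrow _ _ h)
  clear h hr hc
  induction d with
  | zero => exact h'
  | succ d ih => exact ih (hcol _ _ h')

lemma boxCount_youngDiagram (μ : YoungDiagram) (f : ℤ → ℕ)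
    (hμ : ∀ r c : ℕ, (r, c) ∈ μ ↔ min r c < f (c - r)) (i : ℤ) :
    boxCount (μ.colLen 0) (fun r => μ.rowLen r) i = f i := by
  rw [boxCount, ← Finset.card_range (f i)]
  refine Finset.card_bij (fun p _ => min (p.1 : ℕ) (p.2 - 1)) ?_ ?_ ?_
  · rintro ⟨r, c⟩ h
    simp only [Finset.mem_filter, Finset.mem_sigma, Finset.mem_univ, true_and,
      Finset.mem_Icc] at h
    obtain ⟨⟨h₁, h₂⟩, rfl⟩ := h
    have := (hμ r (c - 1)).1 (YoungDiagram.mem_iff_lt_rowLen.2 (by omega))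
    rw [show ((c - 1 : ℕ) : ℤ) - (r : ℕ) = c - ((r : ℕ) + 1 : ℤ) by omega] at this
    exact Finset.mem_range.2 this
  · rintro ⟨r, c⟩ h ⟨r', c'⟩ h' heq
    simp only [Finset.mem_filter, Finset.mem_sigma, Finset.mem_univ, true_and,
      Finset.mem_Icc] at h h' heq
    obtain rfl : r = r' := Fin.ext (by omega)
    obtain rfl : c = c' := by omega
    rfl
  · intro k hk
    rw [Finset.mem_range] at hk
    have hmem : (k + (-i).toNat, k + i.toNat) ∈ μ := by
      rw [hμ, show min (k + (-i).toNat) (k + i.toNat) = k by omega,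
        show ((k + i.toNat : ℕ) : ℤ) - (k + (-i).toNat : ℕ) = i by omega]
      exact hk
    have hcol : k + (-i).toNat < μ.colLen 0 :=
      YoungDiagram.mem_iff_lt_colLen.1 (μ.up_left_mem le_rfl (Nat.zero_le _) hmem)
    have hrow := YoungDiagram.mem_iff_lt_rowLen.1 hmem
    refine ⟨⟨⟨k + (-i).toNat, hcol⟩, k + i.toNat + 1⟩, ?_, ?_⟩
    · simp only [Finset.mem_filter, Finset.mem_sigma, Finset.mem_univ, true_and,
        Finset.mem_Icc]
      omega
    · dsimp only
      omega

/-- The dimension of an internal direct sum, if each summand has as many dimensions as a fibre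
of a map on a finite set has elements. -/
lemma DirectSum.IsInternal.finrank_eq_card_of_fibers {K V ι α : Type*} [Field K]
    [AddCommGroup V] [Module K V] [FiniteDimensional K V] [DecidableEq ι]
    {G : ι → Submodule K V} (hG : DirectSum.IsInternal G) (s : Finset α) (g : α → ι)
    (h : ∀ i, Module.finrank K (G i) = (s.filter fun p => g p = i).card) :
    Module.finrank K V = s.card := by
  rw [Module.finrank_eq_nat_card_basis
    (hG.collectedBasis fun i => Module.finBasis K (G i)),
    ← Nat.card_eq_finsetCard s]
  refine Nat.card_congr (Equiv.trans (Equiv.sigmaCongrRight fun i => ?_)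
    (Equiv.sigmaFiberEquiv fun p : s => g p))
  refine (finCongr (h i)).trans ((Finset.equivFin _).symm.trans ?_)
  exact (Equiv.subtypeEquivRight fun p => Finset.mem_filter).trans
    (Equiv.subtypeSubtypeEquivSubtypeInter (· ∈ s) fun p => g p = i).symm

namespace E2Mod

variable (M : E2Mod)

lemma mem_wt_iff {k : ℤ} {v : M.V} : v ∈ M.wt k ↔ M.L v = (k : ℂ) • v := by
  simp [wt, sub_eq_zero]

lemma Pp_mem_wt {k : ℤ} {v : M.V} (hv : v ∈ M.wt k) : M.Pp v ∈ M.wt (k + 1) := by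
  have h := LinearMap.congr_fun M.relp v
  rw [mem_wt_iff] at hv ⊢
  simp only [LinearMap.sub_apply, LinearMap.comp_apply, hv, map_smul] at h
  rw [sub_eq_iff_eq_add.1 h]
  push_cast
  module

lemma Pm_mem_wt {k : ℤ} {v : M.V} (hv : v ∈ M.wt k) : M.Pm v ∈ M.wt (k - 1) := by
  have h := LinearMap.congr_fun M.relm v
  rw [mem_wt_iff] at hv ⊢
  simp only [LinearMap.sub_apply, LinearMap.comp_apply, hv, map_smul,
    LinearMap.neg_apply] at h
  rw [sub_eq_iff_eq_add.1 h]
  push_cast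
  module

lemma commute : Commute (M.Pp : Module.End ℂ M.V) M.Pm := M.comm

variable {M}

lemma monomialSpan_le_wt {a : ℤ} {u : M.V} (hu : u ∈ M.wt a) (i : ℤ) :
    monomialSpan M.Pp M.Pm u i ≤ M.wt (a + i) := by
  rw [monomialSpan, Submodule.span_le]
  rintro _ ⟨m, n, rfl, rfl⟩
  have hn (n : ℕ) : (M.Pm ^ n) u ∈ M.wt (a - n) := by
    induction n with
    | zero => simpa using hu
    | succ n ih =>
      rw [pow_succ', Nat.cast_succ, ← sub_sub]
      exact M.Pm_mem_wt ih
  induction m with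
  | zero => simpa [← sub_eq_add_neg] using hn n
  | succ m ih =>
    rw [pow_succ', Nat.cast_succ, show a + ((m : ℤ) + 1 - n) = a + (m - n) + 1 by ring]
    exact M.Pp_mem_wt ih

lemma iSup_monomialSpan {a : ℤ} {u : M.V} (hu : u ∈ M.wt a) (hgen : M.GenBy {u}) :
    ⨆ i, monomialSpan M.Pp M.Pm u i = ⊤ := by
  have inv (T : Module.End ℂ M.V)
      (hT : ∀ i, ∃ j, (monomialSpan M.Pp M.Pm u i).map T ≤ monomialSpan M.Pp M.Pm u j) :
      ∀ v ∈ ⨆ i, monomialSpan M.Pp M.Pm u i, T v ∈ ⨆ i, monomialSpan M.Pp M.Pm u i := by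
    suffices h : ⨆ i, monomialSpan M.Pp M.Pm u i ≤
        (⨆ i, monomialSpan M.Pp M.Pm u i).comap T from fun v hv => h hv
    refine iSup_le fun i => ?_
    obtain ⟨j, hj⟩ := hT i
    exact Submodule.map_le_iff_le_comap.1 (hj.trans (le_iSup _ j))
  refine hgen _ ⟨inv _ fun i => ⟨_, map_left_monomialSpan_le _ _ u i⟩,
    inv _ fun i => ⟨_, map_right_monomialSpan_le M.commute u i⟩,
    inv _ fun i => ⟨i, ?_⟩⟩ ?_
  · rintro _ ⟨v, hv, rfl⟩
    rw [M.mem_wt_iff.1 (monomialSpan_le_wt hu i hv)]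
    exact Submodule.smul_mem _ _ hv
  · rw [Set.singleton_subset_iff]
    exact Submodule.mem_iSup_of_mem 0 (Submodule.subset_span ⟨0, 0, by simp, by simp⟩)

lemma monomialSpan_eq_wt {a : ℤ} {u : M.V} (hu : u ∈ M.wt a) (hgen : M.GenBy {u}) (i : ℤ) :
    monomialSpan M.Pp M.Pm u i = M.wt (a + i) := by
  have hind : iSupIndep fun i => M.wt (a + i) :=
    M.internal.submodule_iSupIndep.comp (add_right_injective a)
  exact congr_fun (hind.eq_of_le_of_iSup_eq_top (monomialSpan_le_wt hu)
    (iSup_monomialSpan hu hgen)) i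

end E2Mod

/-- If an `e(2)`-module `V` is generated by a single weight vector of weight `a`, then
there is a partition `λ` (of `dim V`) such that `dim V_{a+i}` is the number of boxes of
residue `i` in the Young diagram of `λ`, for all `i`. -/
theorem stmt_9 (a : ℤ) (M : E2Mod)
    (u : M.V) (hu : u ∈ M.wt a) (hu0 : u ≠ 0) (hgen : M.GenBy {u}) :
    ∃ (l : ℕ) (lam : Fin l → ℕ),
      (∀ r : Fin l, 0 < lam r) ∧
      (∀ r s : Fin l, r ≤ s → lam s ≤ lam r) ∧
      (∑ r : Fin l, lam r = Module.finrank ℂ M.V) ∧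
      (∀ i : ℤ, Module.finrank ℂ (M.wt (a + i)) = boxCount l lam i) := by
  classical
  let f : ℤ → ℕ := fun i => Module.finrank ℂ (M.wt (a + i))
  have hf (i : ℤ) : f i = Module.finrank ℂ (monomialSpan M.Pp M.Pm u i) := by
    rw [E2Mod.monomialSpan_eq_wt hu hgen]
  have hf' (i : ℤ) : f i = Module.finrank ℂ (monomialSpan M.Pm M.Pp u (-i)) := by
    rw [hf, monomialSpan_swap M.commute]
  have hind : iSupIndep fun i => M.wt (a + i) :=
    M.internal.submodule_iSupIndep.comp (add_right_injective a)
  have hsupp : f.support.Finite :=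
    (WellFoundedGT.finite_ne_bot_of_iSupIndep hind).subset fun i hi h =>
      hi ((congrArg (fun W : Submodule ℂ M.V => Module.finrank ℂ W) h).trans
        (finrank_bot ℂ M.V))
  obtain ⟨μ, hμ⟩ := exists_youngDiagram_of_steps f hsupp
    (fun i hi => by
      rw [hf, hf]
      exact ⟨finrank_monomialSpan_add_one_le _ _ u hi,
        finrank_monomialSpan_le_add_one M.commute u i⟩)
    (fun i hi => by
      rw [hf', hf', neg_sub, sub_eq_neg_add]
      exact ⟨finrank_monomialSpan_add_one_le _ _ u (by omega),
        finrank_monomialSpan_le_add_one M.commute.symm u (-i)⟩)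
  have hbox (i : ℤ) := boxCount_youngDiagram μ f hμ i
  refine ⟨μ.colLen 0, fun r => μ.rowLen r, fun r => ?_,
    fun r s hrs => μ.rowLen_anti _ _ hrs, ?_, fun i => (hbox i).symm⟩
  · exact YoungDiagram.mem_iff_lt_rowLen.1 (YoungDiagram.mem_iff_lt_colLen.2 r.2)
  · rw [M.internal.finrank_eq_card_of_fibers
      (Finset.univ.sigma fun r : Fin (μ.colLen 0) => Finset.Icc 1 (μ.rowLen r))
      (fun p => a + ((p.2 : ℤ) - ((p.1 : ℕ) + 1 : ℤ))) fun k => ?_]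
    · simp
    · have h := hbox (k - a)
      have hk : f (k - a) = Module.finrank ℂ (M.wt k) := by
        simp only [f]
        rw [add_sub_cancel]
      refine (h.trans hk).symm.trans ?_
      rw [boxCount]
      congr 1
      refine Finset.filter_congr fun p _ => ?_
      omega
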